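/- Local limit theorem: let δ ∈ (0, 1/2), let x ∈ ℝ, and let B ⊂ ℝ be a bounded set whose topological boundary has Lebesgue measure zero (i.e. B is Jordan measurable) and whose Lebesgue measure J(B) is positive. Then lim_{n → ∞} (log n)^δ · P((f_0(T_n) − μ_n)/σ_n − x ∈ (log n)^{−δ}·B) = (e^{−x²/2}/√(2π))·J(B), where P((f_0(T_n) − μ_n)/σ_n − x ∈ A) := Σ_{k : (k − μ_n)/σ_n − x ∈ A} p_k^(n) and (log n)^{−δ}·B denotes the dilation {(log n)^{−δ}·b : b ∈ B}. -/

import Mathlib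

open Finset

/-- `p n k` is the probability `p_k^{(n)} = P(f_0(T_n) = k)` that the random convex chain
`T_n` has exactly `k` vertices (besides the two corners), given by Buchta's formula:
`p_k^{(n)} = 2^k · Σ_{i_1+⋯+i_k = n, i_j ≥ 1} Π_{j=1}^{k} i_j / (s_j (s_j + 1))`,
where `s_j = i_1 + ⋯ + i_j`.  In particular `p 0 0 = 1` and `p n 0 = 0` for `n ≥ 1`,
and `p n k = 0` for `k > n`. -/
noncomputable def p (n k : ℕ) : ℝ :=
  2 ^ k *
    ∑ i ∈ (Fintype.piFinset fun _ : Fin k => Finset.Icc 1 n).filter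
        (fun i => ∑ j, i j = n),
      ∏ j : Fin k,
        (i j : ℝ) /
          (((∑ l ∈ Finset.univ.filter (fun l => l ≤ j), i l : ℕ) : ℝ) *
            (((∑ l ∈ Finset.univ.filter (fun l => l ≤ j), i l : ℕ) : ℝ) + 1))

/-- The mean `μ_n = E f_0(T_n) = Σ_{k=1}^n k p_k^{(n)}`. -/
noncomputable def μ (n : ℕ) : ℝ := ∑ k ∈ Finset.Icc 1 n, (k : ℝ) * p n k

/-- The variance `σ_n² = Var f_0(T_n) = Σ_{k=1}^n (k − μ_n)² p_k^{(n)}`. -/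
noncomputable def σsq (n : ℕ) : ℝ := ∑ k ∈ Finset.Icc 1 n, ((k : ℝ) - μ n) ^ 2 * p n k

theorem sum_filter_le_castSucc {k : ℕ} (i : Fin (k + 1) → ℕ) (j : Fin k) :
    ∑ l ∈ Finset.univ.filter (fun l => l ≤ j.castSucc), i l =
      ∑ l ∈ Finset.univ.filter (fun l => l ≤ j), i l.castSucc := by
  simp [Finset.sum_filter, Fin.sum_univ_castSucc]

theorem sum_filter_le_last {k : ℕ} (i : Fin (k + 1) → ℕ) :
    ∑ l ∈ Finset.univ.filter (fun l => l ≤ Fin.last k), i l = ∑ l, i l := by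
  simp [Fin.le_last]

theorem p_nonneg (n k : ℕ) : 0 ≤ p n k := by
  unfold p
  positivity

theorem p_zero_zero : p 0 0 = 1 := by
  simp [p]

theorem p_succ_zero (n : ℕ) : p (n + 1) 0 = 0 := by
  simp [p]

/-- Conditioning on the last part `i_k = n - m`. -/
theorem p_succ_right (n k : ℕ) :
    (n : ℝ) * (n + 1) * p n (k + 1) = 2 * ∑ m ∈ Finset.range n, ((n : ℝ) - m) * p m k := by
  rcases Nat.eq_zero_or_pos n with rfl | hn
  · simp
  have hn' : (0 : ℝ) < n := by exact_mod_cast hn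
  unfold p
  simp only [Finset.mul_sum]
  rw [Finset.sum_sigma']
  refine Finset.sum_nbij' (fun i => ⟨n - i (Fin.last k), fun j => i j.castSucc⟩)
    (fun x => Fin.snoc x.2 (n - x.1)) ?_ ?_ ?_ ?_ ?_
  · intro i hi
    simp only [Finset.mem_filter, Fintype.mem_piFinset, Finset.mem_Icc, Fin.sum_univ_castSucc,
      Finset.mem_sigma, Finset.mem_range] at hi ⊢
    have h0 := hi.1 (Fin.last k)
    refine ⟨by omega, fun j => ⟨(hi.1 _).1, ?_⟩, by omega⟩
    have := Finset.single_le_sum (f := fun j : Fin k => i j.castSucc)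
      (fun _ _ => Nat.zero_le _) (Finset.mem_univ j)
    omega
  · rintro ⟨m, i⟩ hi
    simp only [Finset.mem_filter, Fintype.mem_piFinset, Finset.mem_Icc, Fin.sum_univ_castSucc,
      Finset.mem_sigma, Finset.mem_range, Fin.snoc_castSucc, Fin.snoc_last] at hi ⊢
    refine ⟨fun j => ?_, by omega⟩
    refine Fin.lastCases ?_ (fun j => ?_) j
    · simp only [Fin.snoc_last]; omega
    · have := hi.2.1 j
      simp only [Fin.snoc_castSucc]; omega
  · intro i hi
    simp only [Finset.mem_filter, Fintype.mem_piFinset, Finset.mem_Icc] at hi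
    have h0 := hi.1 (Fin.last k)
    have : n - (n - i (Fin.last k)) = i (Fin.last k) := by omega
    simp only [this]
    exact Fin.snoc_init_self i
  · rintro ⟨m, i⟩ hi
    simp only [Finset.mem_sigma, Finset.mem_range] at hi
    simp only [Fin.snoc_last, Fin.snoc_castSucc]
    congr 1
    omega
  · intro i hi
    simp only [Finset.mem_filter, Fintype.mem_piFinset, Finset.mem_Icc] at hi
    have h0 := hi.1 (Fin.last k)
    rw [Fin.prod_univ_castSucc]
    simp only [sum_filter_le_castSucc, sum_filter_le_last, hi.2]
    rw [Nat.cast_sub h0.2]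
    field_simp
    ring

theorem p_eq_zero_of_lt {n k : ℕ} (h : n < k) : p n k = 0 := by
  induction k generalizing n with
  | zero => omega
  | succ k ih =>
    rcases Nat.eq_zero_or_pos n with rfl | hn
    · simp [p]
    · have h1 := p_succ_right n k
      rw [Finset.sum_eq_zero fun m hm => by
        rw [ih (by have := Finset.mem_range.1 hm; omega), mul_zero]] at h1
      have hn' : (0 : ℝ) < n := by exact_mod_cast hn
      have : (n : ℝ) * (n + 1) ≠ 0 := by positivity
      simpa [this, hn.ne', hn'.ne'] using h1

theorem p_recurrence (n k : ℕ) :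
    ((n : ℝ) + 2) * (n + 3) * p (n + 2) (k + 1) =
      2 * (n + 1) * (n + 2) * p (n + 1) (k + 1) + 2 * p (n + 1) k
        - n * (n + 1) * p n (k + 1) := by
  have h2 := p_succ_right (n + 2) k
  have h1 := p_succ_right (n + 1) k
  have h0 := p_succ_right n k
  have e : ∑ m ∈ Finset.range n, ((n : ℝ) + 2 - m) * p m k =
      2 * ∑ m ∈ Finset.range n, ((n : ℝ) + 1 - m) * p m k
        - ∑ m ∈ Finset.range n, ((n : ℝ) - m) * p m k := by
    rw [Finset.mul_sum, ← Finset.sum_sub_distrib]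
    exact Finset.sum_congr rfl fun m _ => by ring
  rw [Finset.sum_range_succ, Finset.sum_range_succ] at h2
  rw [Finset.sum_range_succ] at h1
  push_cast at h2 h1
  rw [e] at h2
  linarith

/-- The probability generating function of `p n ·`. -/
noncomputable def genPoly (n : ℕ) : Polynomial ℝ :=
  ∑ k ∈ Finset.range (n + 1), Polynomial.C (p n k) * Polynomial.X ^ k

open Polynomial in
theorem coeff_genPoly (n k : ℕ) : (genPoly n).coeff k = p n k := by
  simp only [genPoly, finsetSum_coeff, coeff_C_mul, coeff_X_pow, mul_ite, mul_one, mul_zero,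
    Finset.sum_ite_eq, Finset.mem_range]
  split_ifs with h
  · rfl
  · rw [p_eq_zero_of_lt (by omega)]

open Polynomial in
theorem genPoly_zero : genPoly 0 = 1 := by
  simp [genPoly, p_zero_zero]

theorem p_one_one : p 1 1 = 1 := by
  have := p_succ_right 1 0
  simp only [Finset.sum_range_one, p_zero_zero] at this
  norm_num at this
  linarith

open Polynomial in
theorem genPoly_one : genPoly 1 = X := by
  simp [genPoly, Finset.sum_range_succ, p_succ_zero 0, p_one_one]

open Polynomial in
theorem genPoly_recurrence (n : ℕ) :
    C (((n : ℝ) + 2) * (n + 3)) * genPoly (n + 2) =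
      (C (2 * ((n : ℝ) + 1) * (n + 2)) + C 2 * X) * genPoly (n + 1)
        - C ((n : ℝ) * (n + 1)) * genPoly n := by
  ext k
  rw [add_mul (C _) (C 2 * X), mul_assoc (C 2)]
  simp only [coeff_sub, coeff_add, coeff_C_mul]
  cases k with
  | zero =>
    simp only [coeff_X_mul_zero, coeff_genPoly, p_succ_zero]
    cases n <;> simp [p_succ_zero]
  | succ k =>
    simp only [coeff_X_mul, coeff_genPoly]
    exact p_recurrence n k

open Polynomial in
theorem aeval_genPoly_recurrence {A : Type*} [CommRing A] [Algebra ℝ A] (n : ℕ) (z : A) :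
    algebraMap ℝ A (((n : ℝ) + 2) * (n + 3)) * aeval z (genPoly (n + 2)) =
      (algebraMap ℝ A (2 * ((n : ℝ) + 1) * (n + 2)) + algebraMap ℝ A 2 * z)
          * aeval z (genPoly (n + 1))
        - algebraMap ℝ A ((n : ℝ) * (n + 1)) * aeval z (genPoly n) := by
  have := congrArg (aeval z) (genPoly_recurrence n)
  simpa only [map_mul, map_add, map_sub, aeval_C, aeval_X] using this

open Polynomial in
theorem eval_one_genPoly (n : ℕ) : (genPoly n).eval 1 = 1 := by
  induction n using Nat.twoStepInduction with
  | zero => simp [genPoly_zero]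
  | one => simp [genPoly_one]
  | more n h0 h1 =>
    have := congrArg (eval 1) (genPoly_recurrence n)
    simp only [eval_mul, eval_add, eval_sub, eval_C, eval_X, h0, h1] at this
    have hpos : ((n : ℝ) + 2) * (n + 3) ≠ 0 := by positivity
    apply mul_left_cancel₀ hpos
    rw [this]; ring

open Polynomial in
theorem aeval_genPoly_ne_zero_of_im_pos {z : ℂ} (hz : 0 < z.im) (n : ℕ) :
    aeval z (genPoly n) ≠ 0 := by
  have hz0 : z ≠ 0 := by rintro rfl; simp at hz
  have key : ∀ n : ℕ, aeval z (genPoly (n + 1)) ≠ 0 ∧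
      0 < (aeval z (genPoly (n + 1)) * (starRingEnd ℂ) (aeval z (genPoly n))).im := by
    intro n
    induction n with
    | zero => simpa [genPoly_one, genPoly_zero, hz0] using hz
    | succ n ih =>
      obtain ⟨hne, him⟩ := ih
      have hrec := aeval_genPoly_recurrence n z
      set a := aeval z (genPoly (n + 2))
      set b := aeval z (genPoly (n + 1))
      set c := aeval z (genPoly n)
      have h1 := congrArg (fun w => (w * (starRingEnd ℂ) b).im) hrec
      simp only [Complex.coe_algebraMap, Complex.mul_im, Complex.mul_re, Complex.sub_im,
        Complex.sub_re, Complex.add_im, Complex.add_re, Complex.conj_re, Complex.conj_im,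
        Complex.ofReal_re, Complex.ofReal_im] at h1 him
      have hpos : 0 < ((n : ℝ) + 2) * (n + 3) := by positivity
      have hb : 0 < b.re ^ 2 + b.im ^ 2 := by
        have := Complex.normSq_pos.2 hne
        rw [Complex.normSq_apply] at this
        nlinarith
      have hn : 0 ≤ (n : ℝ) * (n + 1) := by positivity
      have h2 : 0 < (a * (starRingEnd ℂ) b).im := by
        simp only [Complex.mul_im, Complex.conj_re, Complex.conj_im]
        have h3 := mul_nonneg hn him.le
        have h4 := mul_pos hz hb
        refine pos_of_mul_pos_right (a := ((n : ℝ) + 2) * (n + 3)) ?_ hpos.le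
        nlinarith
      refine ⟨?_, h2⟩
      intro ha
      simp [show a = 0 from ha] at h2
  cases n with
  | zero => simp [genPoly_zero]
  | succ n => exact (key n).1

open Polynomial in
theorem im_eq_zero_of_aeval_genPoly_eq_zero {z : ℂ} {n : ℕ} (h : aeval z (genPoly n) = 0) :
    z.im = 0 := by
  rcases lt_trichotomy z.im 0 with hz | hz | hz
  · refine absurd ?_ (aeval_genPoly_ne_zero_of_im_pos (z := (starRingEnd ℂ) z) (by simpa) n)
    rw [aeval_conj, h, map_zero]
  · exact hz
  · exact absurd h (aeval_genPoly_ne_zero_of_im_pos hz n)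

open Polynomial in
theorem eval_genPoly_pos {x : ℝ} (hx : 0 < x) (n : ℕ) : 0 < (genPoly n).eval x := by
  have h1 := eval_one_genPoly n
  simp only [genPoly, eval_finsetSum, eval_mul, eval_C, eval_pow, eval_X, one_pow,
    mul_one] at h1 ⊢
  refine (Finset.sum_nonneg fun k _ => mul_nonneg (p_nonneg n k) (by positivity)).lt_of_ne' ?_
  intro h0
  rw [Finset.sum_eq_zero_iff_of_nonneg
    (fun k _ => mul_nonneg (p_nonneg n k) (by positivity))] at h0
  rw [Finset.sum_eq_zero fun k hk => ?_] at h1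
  · exact zero_ne_one h1
  · exact (mul_eq_zero.1 (h0 k hk)).resolve_right (by positivity)

open Polynomial in
/-- `p n ·` is the law of a sum of independent Bernoulli variables. -/
theorem exists_genPoly_eq_prod (n : ℕ) : ∃ s : Multiset ℝ, (∀ q ∈ s, 0 ≤ q ∧ q ≤ 1) ∧
    genPoly n = (s.map fun q => C q * X + C (1 - q)).prod := by
  set f := (genPoly n).map (algebraMap ℝ ℂ) with hf
  have hne : f ≠ 0 := by
    rw [hf, Ne, Polynomial.map_eq_zero]
    intro h
    simpa [h] using eval_one_genPoly n
  have hroot : ∀ r ∈ f.roots, (r.re : ℂ) = r ∧ r.re ≤ 0 := by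
    intro r hr
    have h0 : aeval r (genPoly n) = 0 := by
      rw [← eval_map_algebraMap]; exact (mem_roots hne).1 hr
    have him : (r.re : ℂ) = r :=
      Complex.ext (by simp) (by simp [im_eq_zero_of_aeval_genPoly_eq_zero h0])
    refine ⟨him, ?_⟩
    by_contra! hpos
    have h1 := eval_genPoly_pos hpos n
    rw [← him] at h0
    rw [← Complex.coe_algebraMap, aeval_algebraMap_apply, Complex.coe_algebraMap,
      Complex.ofReal_eq_zero] at h0
    exact h1.ne' h0
  refine ⟨f.roots.map fun r => 1 / (1 - r.re), ?_, ?_⟩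
  · intro q hq
    obtain ⟨r, hr, rfl⟩ := Multiset.mem_map.1 hq
    have := (hroot r hr).2
    refine ⟨div_nonneg zero_le_one (by linarith), ?_⟩
    rw [div_le_one (by linarith)]; linarith
  · apply map_injective (algebraMap ℝ ℂ) (algebraMap ℝ ℂ).injective
    have hsplit : f = C f.leadingCoeff * (f.roots.map fun a => X - C a).prod :=
      (IsAlgClosed.splits f).eq_prod_roots
    have hone : f.leadingCoeff * (f.roots.map fun a => 1 - a).prod = 1 := by
      have h1 : f.eval 1 = 1 := by
        rw [hf, eval_map_algebraMap, ← map_one (algebraMap ℝ ℂ), aeval_algebraMap_apply,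
          coe_aeval_eq_eval, eval_one_genPoly]
      rw [hsplit] at h1
      rw [eval_mul, eval_C, eval_multiset_prod, Multiset.map_map] at h1
      simpa using h1
    rw [← hf]
    conv_lhs => rw [hsplit]
    rw [Polynomial.map_multiset_prod, Multiset.map_map, Multiset.map_map]
    have hfac : (f.roots.map ((Polynomial.map (algebraMap ℝ ℂ) ∘
          (fun q => C q * X + C (1 - q))) ∘ fun r : ℂ => 1 / (1 - r.re))) =
        f.roots.map fun r => C (1 / (1 - r)) * (X - C r) := by
      refine Multiset.map_congr rfl fun r hr => ?_
      obtain ⟨him, hle⟩ := hroot r hr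
      have hne1 : (1 - r : ℂ) ≠ 0 := by
        rw [← him]; norm_cast; linarith
      simp only [Function.comp, Polynomial.map_add, Polynomial.map_mul, map_C, map_X,
        Complex.coe_algebraMap]
      push_cast
      rw [him, mul_sub, ← C_mul, sub_eq_add_neg (C _ * X), ← C_neg]
      congr 2
      field_simp
      ring
    rw [hfac, Multiset.prod_map_mul]
    congr 1
    rw [Multiset.prod_hom' f.roots C]
    congr 1
    have hinv : (f.roots.map fun r => 1 / (1 - r)).prod * (f.roots.map fun r => 1 - r).prod = 1 := by
      rw [← Multiset.prod_map_mul, Multiset.map_congr rfl (g := fun _ => (1 : ℂ)),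
        Multiset.prod_map_one]
      intro r hr
      obtain ⟨him, hle⟩ := hroot r hr
      have hne1 : (1 - r : ℂ) ≠ 0 := by
        rw [← him]; norm_cast; linarith
      exact one_div_mul_cancel hne1
    linear_combination (f.roots.map fun r => 1 / (1 - r)).prod * hone - f.leadingCoeff * hinv

open Polynomial in
theorem eval_one_derivative_genPoly_sub (n : ℕ) :
    (derivative (genPoly (n + 2))).eval 1 - (derivative (genPoly (n + 1))).eval 1 =
      2 / (3 * ((n : ℝ) + 2)) := by
  have hrec : ∀ n : ℕ, ((n : ℝ) + 2) * (n + 3) * ((derivative (genPoly (n + 2))).eval 1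
      - (derivative (genPoly (n + 1))).eval 1) = n * (n + 1) *
        ((derivative (genPoly (n + 1))).eval 1 - (derivative (genPoly n)).eval 1) + 2 := by
    intro n
    have := congrArg (fun f => eval 1 (derivative f)) (genPoly_recurrence n)
    simp only [derivative_mul, derivative_add, derivative_sub, derivative_C, derivative_X, eval_mul,
      eval_add, eval_sub, eval_C, eval_X, eval_zero, eval_one, eval_one_genPoly] at this
    linarith
  induction n with
  | zero =>
    have h := hrec 0
    norm_num at h ⊢
    linarith
  | succ n ih =>
    have h := hrec (n + 1)
    rw [show n + 1 + 1 = n + 2 from rfl, ih] at h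
    have hpos : ((n : ℝ) + 3) * (n + 4) ≠ 0 := by positivity
    apply mul_left_cancel₀ hpos
    push_cast at h ⊢
    rw [show ((n : ℝ) + 3) * (n + 4) = (n + 1 + 2) * (n + 1 + 3) by ring, h]
    field_simp
    ring

open Polynomial in
theorem eval_one_derivative_derivative_genPoly_sub (n : ℕ) :
    (derivative (derivative (genPoly (n + 2)))).eval 1
        - (derivative (derivative (genPoly (n + 1)))).eval 1 =
      4 / 3 * (derivative (genPoly (n + 1))).eval 1 / ((n : ℝ) + 2)
        - 4 / 27 * (n * (2 * n + 7)) / (((n : ℝ) + 2) ^ 2 * (n + 3)) := by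
  have hrec : ∀ n : ℕ, ((n : ℝ) + 2) * (n + 3) * ((derivative (derivative (genPoly (n + 2)))).eval 1
      - (derivative (derivative (genPoly (n + 1)))).eval 1) = n * (n + 1) *
        ((derivative (derivative (genPoly (n + 1)))).eval 1
          - (derivative (derivative (genPoly n))).eval 1)
        + 4 * (derivative (genPoly (n + 1))).eval 1 := by
    intro n
    have := congrArg (fun f => eval 1 (derivative (derivative f))) (genPoly_recurrence n)
    simp only [derivative_mul, derivative_add, derivative_sub, derivative_C, derivative_X, eval_mul,
      eval_add, eval_sub, eval_C, eval_X, eval_zero, eval_one, derivative_zero,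
      derivative_one] at this
    linarith
  induction n with
  | zero =>
    have h := hrec 0
    norm_num at h ⊢
    linarith
  | succ n ih =>
    have h := hrec (n + 1)
    have hm := eval_one_derivative_genPoly_sub n
    rw [show n + 1 + 1 = n + 2 from rfl, ih] at h
    rw [show n + 1 + 1 = n + 2 from rfl]
    rw [sub_eq_iff_eq_add] at hm
    rw [hm] at h ⊢
    have hpos : ((n : ℝ) + 3) * (n + 4) ≠ 0 := by positivity
    apply mul_left_cancel₀ hpos
    push_cast at h ⊢
    rw [show ((n : ℝ) + 3) * (n + 4) = (n + 1 + 2) * (n + 1 + 3) by ring, h]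
    field_simp
    ring

open Polynomial in
theorem derivative_genPoly_eval_one (n : ℕ) : (derivative (genPoly n)).eval 1 = μ n := by
  rw [genPoly, Finset.range_eq_Ico, Finset.sum_eq_sum_Ico_succ_bot (Nat.succ_pos n)]
  simp only [derivative_add, derivative_sum, eval_add, eval_finsetSum, derivative_C_mul_X_pow]
  simp [μ, Finset.Ico_add_one_right_eq_Icc, mul_comm]

theorem sum_Icc_p {n : ℕ} (hn : 1 ≤ n) : ∑ k ∈ Finset.Icc 1 n, p n k = 1 := by
  have h := eval_one_genPoly n
  obtain ⟨m, rfl⟩ := Nat.exists_eq_add_of_le' hn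
  rw [genPoly, Finset.range_eq_Ico, Finset.sum_eq_sum_Ico_succ_bot (Nat.succ_pos _)] at h
  simpa [p_succ_zero, Polynomial.eval_finsetSum, Finset.Ico_add_one_right_eq_Icc] using h

open Polynomial in
theorem derivative_derivative_genPoly_eval_one (n : ℕ) :
    (derivative (derivative (genPoly n))).eval 1 =
      ∑ k ∈ Finset.Icc 1 n, (k : ℝ) * (k - 1) * p n k := by
  rw [genPoly, Finset.range_eq_Ico, Finset.sum_eq_sum_Ico_succ_bot (Nat.succ_pos n)]
  simp only [derivative_add, derivative_sum, eval_add, eval_finsetSum, derivative_C_mul_X_pow]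
  simp only [zero_add, CharP.cast_eq_zero, mul_zero, map_zero, zero_mul, eval_zero,
    eval_mul, eval_C, eval_pow, eval_X, one_pow, mul_one]
  refine Finset.sum_congr rfl fun k hk => ?_
  rw [Nat.cast_pred (Finset.mem_Icc.1 hk).1]
  ring

open Polynomial in
theorem σsq_eq {n : ℕ} (hn : 1 ≤ n) :
    σsq n = (derivative (derivative (genPoly n))).eval 1 + μ n - μ n ^ 2 := by
  rw [derivative_derivative_genPoly_eval_one, σsq]
  have h1 := sum_Icc_p hn
  have h : ∀ k : ℕ, ((k : ℝ) - μ n) ^ 2 * p n k =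
      (k : ℝ) * (k - 1) * p n k + k * p n k - 2 * μ n * (k * p n k) + μ n ^ 2 * p n k := by
    intro k; ring
  simp only [h, Finset.sum_add_distrib, Finset.sum_sub_distrib, ← Finset.mul_sum, h1]
  rw [show ∑ k ∈ Finset.Icc 1 n, (k : ℝ) * p n k = μ n from rfl]
  ring

theorem le_σsq_succ_sub (n : ℕ) : 10 / 27 / ((n : ℝ) + 2) ≤ σsq (n + 2) - σsq (n + 1) := by
  rw [σsq_eq (by omega), σsq_eq (by omega)]
  have h2 := eval_one_derivative_derivative_genPoly_sub n
  have h1 := eval_one_derivative_genPoly_sub n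
  rw [derivative_genPoly_eval_one, derivative_genPoly_eval_one] at h1
  rw [derivative_genPoly_eval_one] at h2
  rw [sub_eq_iff_eq_add] at h1 h2
  rw [h1, h2, ← sub_nonneg]
  have : 4 / 3 * μ (n + 1) / (n + 2) - 4 / 27 * (n * (2 * n + 7)) / ((n + 2) ^ 2 * (n + 3)) +
      Polynomial.eval 1 (Polynomial.derivative (Polynomial.derivative (genPoly (n + 1)))) +
      (2 / (3 * (n + 2)) + μ (n + 1)) - (2 / (3 * (n + 2)) + μ (n + 1)) ^ 2 -
      (Polynomial.eval 1 (Polynomial.derivative (Polynomial.derivative (genPoly (n + 1)))) +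
        μ (n + 1) - μ (n + 1) ^ 2) - 10 / 27 / ((n : ℝ) + 2) =
      4 / 9 / ((n + 2) ^ 2 * (n + 3)) := by
    field_simp
    ring
  rw [this]
  positivity

theorem le_σsq (n : ℕ) : 10 / 27 * (Real.log (n + 2) - 1) ≤ σsq (n + 1) := by
  induction n with
  | zero =>
    have : 0 ≤ σsq 1 := Finset.sum_nonneg fun k _ => mul_nonneg (sq_nonneg _) (p_nonneg _ _)
    have h2 := Real.log_two_lt_d9
    norm_num at h2 ⊢
    linarith
  | succ n ih =>
    have h := le_σsq_succ_sub n
    have hlog : Real.log ((n : ℝ) + 1 + 2) - Real.log (n + 2) ≤ 1 / (n + 2) := by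
      rw [← Real.log_div (by positivity) (by positivity)]
      refine (Real.log_le_sub_one_of_pos (by positivity)).trans_eq ?_
      field_simp
      ring
    push_cast
    have e : (10 : ℝ) / 27 / (n + 2) = 10 / 27 * (1 / (n + 2)) := by ring
    rw [show n + 1 + 1 = n + 2 from rfl]
    linarith

theorem mul_log_sub_one_le_σsq {n : ℕ} (hn : 1 ≤ n) : 10 / 27 * (Real.log n - 1) ≤ σsq n := by
  obtain ⟨m, rfl⟩ := Nat.exists_eq_add_of_le' hn
  refine le_trans ?_ (le_σsq m)
  have : Real.log ((m + 1 : ℕ) : ℝ) ≤ Real.log (m + 2) :=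
    Real.log_le_log (by positivity) (by push_cast; linarith)
  linarith

theorem tendsto_log_natCast : Filter.Tendsto (fun n : ℕ => Real.log n) Filter.atTop Filter.atTop :=
  Real.tendsto_log_atTop.comp tendsto_natCast_atTop_atTop

theorem tendsto_σsq : Filter.Tendsto σsq Filter.atTop Filter.atTop := by
  refine Filter.tendsto_atTop_mono' _
    (Filter.eventually_atTop.2 ⟨1, fun n hn => mul_log_sub_one_le_σsq hn⟩) ?_
  exact (Filter.tendsto_atTop_add_const_right _ (-1) tendsto_log_natCast).const_mul_atTop
    (by norm_num)

open Polynomial in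
theorem eval_one_prod_bernoulli (s : Multiset ℝ) :
    ((s.map fun q => C q * X + C (1 - q)).prod).eval 1 = 1 ∧
    (derivative (s.map fun q => C q * X + C (1 - q)).prod).eval 1 = s.sum ∧
    (derivative (derivative (s.map fun q => C q * X + C (1 - q)).prod)).eval 1 =
      s.sum ^ 2 - (s.map fun q => q ^ 2).sum := by
  induction s using Multiset.induction with
  | empty => simp
  | cons q s ih =>
    obtain ⟨h0, h1, h2⟩ := ih
    simp only [Multiset.map_cons, Multiset.prod_cons, Multiset.sum_cons, derivative_mul,
      derivative_add, derivative_C, derivative_X, eval_mul,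
      eval_add, eval_C, eval_X, eval_zero, eval_one, derivative_zero,
      derivative_one, h0, h1, h2]
    refine ⟨by ring, by ring, by ring⟩

theorem μ_eq_sum_of_genPoly_eq {n : ℕ} {s : Multiset ℝ}
    (h : genPoly n = (s.map fun q => Polynomial.C q * Polynomial.X + Polynomial.C (1 - q)).prod) :
    μ n = s.sum := by
  rw [← derivative_genPoly_eval_one, h, (eval_one_prod_bernoulli s).2.1]

theorem σsq_eq_sum_of_genPoly_eq {n : ℕ} (hn : 1 ≤ n) {s : Multiset ℝ}
    (h : genPoly n = (s.map fun q => Polynomial.C q * Polynomial.X + Polynomial.C (1 - q)).prod) :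
    σsq n = (s.map fun q => q * (1 - q)).sum := by
  rw [σsq_eq hn, μ_eq_sum_of_genPoly_eq h, h, (eval_one_prod_bernoulli s).2.2]
  have : (fun q : ℝ => q * (1 - q)) = fun q => q - q ^ 2 := by ext q; ring
  rw [this, Multiset.sum_map_sub, Multiset.map_id']
  ring

/-- Characteristic function of a centred Bernoulli variable with success probability `q`. -/
noncomputable def bernChar (q u : ℝ) : ℂ :=
  q * Complex.exp ((u * (1 - q) : ℝ) * Complex.I) +
    (1 - q) * Complex.exp ((-(u * q) : ℝ) * Complex.I)

theorem bernChar_eq (q u : ℝ) :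
    bernChar q u = Complex.exp (-(u * q * Complex.I)) *
      (q * Complex.exp (u * Complex.I) + (1 - q)) := by
  rw [bernChar, mul_add, mul_left_comm, ← Complex.exp_add, mul_comm (1 - (q : ℂ))]
  push_cast
  congr 3 <;> ring_nf

theorem norm_bernChar_le (q u : ℝ) :
    ‖bernChar q u‖ ≤ Real.exp (-(q * (1 - q)) * (1 - Real.cos u)) := by
  have e : ‖bernChar q u‖ = ‖(q * Complex.exp (u * Complex.I) + (1 - q) : ℂ)‖ := by
    rw [bernChar_eq, norm_mul]
    have : ‖Complex.exp (-(u * q * Complex.I))‖ = 1 := by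
      rw [Complex.norm_exp]; simp
    rw [this, one_mul]
  rw [e]
  refine le_of_sq_le_sq ?_ (Real.exp_pos _).le
  rw [← Complex.normSq_eq_norm_sq, ← Real.exp_nat_mul, Complex.normSq_apply]
  simp only [Complex.add_re, Complex.add_im, Complex.mul_re, Complex.mul_im, Complex.ofReal_re,
    Complex.ofReal_im, Complex.exp_ofReal_mul_I_re, Complex.exp_ofReal_mul_I_im, Complex.sub_re,
    Complex.sub_im, Complex.one_re, Complex.one_im]
  refine le_trans (le_of_eq ?_) (Real.add_one_le_exp _)
  push_cast
  linear_combination q ^ 2 * Real.sin_sq_add_cos_sq u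

theorem norm_exp_mul_I_sub_le {y : ℝ} (hy : |y| ≤ 1) :
    ‖Complex.exp (y * Complex.I) - (1 + y * Complex.I - y ^ 2 / 2)‖ ≤ |y| ^ 3 := by
  have h := Complex.exp_bound (x := y * Complex.I) (by simpa using hy) (n := 3) (by norm_num)
  simp only [Finset.sum_range_succ, Finset.sum_range_zero] at h
  have e : ((y : ℂ) * Complex.I) ^ 2 = -(y : ℂ) ^ 2 := by
    rw [mul_pow, Complex.I_sq]; ring
  rw [e] at h
  simp only [norm_mul, Complex.norm_real, Complex.norm_I, mul_one, Real.norm_eq_abs] at h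
  have h3 : (0 : ℝ) ≤ |y| ^ 3 := by positivity
  calc _ = _ := by
        congr 2
        simp [Nat.factorial]
        ring
    _ ≤ _ := h
    _ ≤ _ := by
        norm_num [Nat.factorial]
        linarith

theorem norm_bernChar_sub_le {q : ℝ} (h0 : 0 ≤ q) (h1 : q ≤ 1) {u : ℝ} (hu : |u| ≤ 1) :
    ‖bernChar q u - Complex.exp ((-(q * (1 - q) * u ^ 2 / 2) : ℝ))‖ ≤
      q * (1 - q) * (2 * |u| ^ 3) := by
  have hq1 : 0 ≤ 1 - q := by linarith
  have hA := norm_exp_mul_I_sub_le (y := u * (1 - q)) (by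
    rw [abs_mul, abs_of_nonneg hq1]; exact mul_le_one₀ hu hq1 (by linarith))
  have hB := norm_exp_mul_I_sub_le (y := -(u * q)) (by
    rw [abs_neg, abs_mul, abs_of_nonneg h0]; exact mul_le_one₀ hu h0 h1)
  rw [abs_mul, abs_of_nonneg hq1, mul_pow] at hA
  rw [abs_neg, abs_mul, abs_of_nonneg h0, mul_pow] at hB
  have hv : 0 ≤ q * (1 - q) := by positivity
  have hv1 : q * (1 - q) ≤ 1 := by nlinarith
  have hu2 : u ^ 2 ≤ 1 := by rw [← sq_abs]; exact pow_le_one₀ (abs_nonneg u) hu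
  have hw : |-(q * (1 - q) * u ^ 2 / 2)| ≤ 1 := by
    rw [abs_neg, abs_of_nonneg (by positivity)]
    have := mul_le_one₀ hv1 (sq_nonneg u) hu2
    linarith
  have hC := Real.abs_exp_sub_one_sub_id_le hw
  have hC' : ‖((Real.exp (-(q * (1 - q) * u ^ 2 / 2)) - 1 - -(q * (1 - q) * u ^ 2 / 2) : ℝ) : ℂ)‖ ≤
      q * (1 - q) * |u| ^ 3 := by
    rw [Complex.norm_real, Real.norm_eq_abs]
    refine hC.trans ?_
    have h4 : u ^ 4 ≤ |u| ^ 3 := by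
      have : u ^ 4 = |u| ^ 4 := (Even.pow_abs ⟨2, rfl⟩ u).symm
      rw [this]
      exact pow_le_pow_of_le_one (abs_nonneg u) hu (by norm_num)
    have h5 : (q * (1 - q)) ^ 2 ≤ q * (1 - q) := by nlinarith
    have h6 : (q * (1 - q)) ^ 2 * u ^ 4 ≤ q * (1 - q) * |u| ^ 3 :=
      mul_le_mul h5 h4 (by positivity) hv
    have h7 : 0 ≤ q * (1 - q) * |u| ^ 3 := by positivity
    nlinarith
  set a := Complex.exp ((u * (1 - q) : ℝ) * Complex.I)
  set b := Complex.exp ((-(u * q) : ℝ) * Complex.I)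
  have e : bernChar q u - Complex.exp ((-(q * (1 - q) * u ^ 2 / 2) : ℝ)) =
      (q : ℂ) * (a - (1 + ((u * (1 - q) : ℝ) : ℂ) * Complex.I - ((u * (1 - q) : ℝ) : ℂ) ^ 2 / 2)) +
      ((1 - q : ℝ) : ℂ) * (b - (1 + ((-(u * q) : ℝ) : ℂ) * Complex.I
        - ((-(u * q) : ℝ) : ℂ) ^ 2 / 2)) -
      ((Real.exp (-(q * (1 - q) * u ^ 2 / 2)) - 1 - -(q * (1 - q) * u ^ 2 / 2) : ℝ) : ℂ) := by
    simp only [bernChar, a, b]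
    push_cast
    ring
  rw [e]
  refine (norm_sub_le _ _).trans ?_
  refine (add_le_add ((norm_add_le _ _).trans (add_le_add (norm_mul_le _ _) (norm_mul_le _ _)))
    hC').trans ?_
  rw [Complex.norm_real, Complex.norm_real, Real.norm_of_nonneg h0, Real.norm_of_nonneg hq1]
  have hA' := mul_le_mul_of_nonneg_left hA h0
  have hB' := mul_le_mul_of_nonneg_left hB hq1
  have h3 : (0 : ℝ) ≤ |u| ^ 3 := by positivity
  have h8 : q * (|u| ^ 3 * (1 - q) ^ 3) + (1 - q) * (|u| ^ 3 * q ^ 3) ≤ q * (1 - q) * |u| ^ 3 := by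
    have : (1 - q) ^ 2 + q ^ 2 ≤ 1 := by nlinarith
    calc _ = q * (1 - q) * |u| ^ 3 * ((1 - q) ^ 2 + q ^ 2) := by ring
      _ ≤ q * (1 - q) * |u| ^ 3 * 1 := by gcongr
      _ = _ := mul_one _
  linarith

theorem norm_multiset_prod_sub_prod_le {ι : Type*} (s : Multiset ι) (f g : ι → ℂ) (d : ι → ℝ)
    (hf : ∀ i ∈ s, ‖f i‖ ≤ 1) (hg : ∀ i ∈ s, ‖g i‖ ≤ 1) (hd : ∀ i ∈ s, ‖f i - g i‖ ≤ d i) :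
    ‖(s.map f).prod - (s.map g).prod‖ ≤ (s.map d).sum ∧ ‖(s.map f).prod‖ ≤ 1 := by
  induction s using Multiset.induction with
  | empty => simp
  | cons a s ih =>
    simp only [Multiset.mem_cons, forall_eq_or_imp] at hf hg hd
    obtain ⟨h1, h2⟩ := ih hf.2 hg.2 hd.2
    simp only [Multiset.map_cons, Multiset.prod_cons, Multiset.sum_cons]
    refine ⟨?_, ?_⟩
    · have e : f a * (s.map f).prod - g a * (s.map g).prod =
          (f a - g a) * (s.map f).prod + g a * ((s.map f).prod - (s.map g).prod) := by ring
      rw [e]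
      refine (norm_add_le _ _).trans (add_le_add ?_ ?_)
      · rw [norm_mul]
        exact (mul_le_of_le_one_right (norm_nonneg _) h2).trans hd.1
      · rw [norm_mul]
        exact (mul_le_of_le_one_left (norm_nonneg _) hg.1).trans h1
    · rw [norm_mul]
      exact mul_le_one₀ hf.1 (norm_nonneg _) h2

/-- Characteristic function of the centred law `p n ·`. -/
noncomputable def centredChar (n : ℕ) (u : ℝ) : ℂ :=
  Complex.exp (-(u * μ n * Complex.I)) *
    Polynomial.aeval (Complex.exp (u * Complex.I)) (genPoly n)

theorem continuous_centredChar (n : ℕ) : Continuous (centredChar n) := by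
  unfold centredChar
  simp only [Polynomial.aeval_def, Polynomial.eval₂_eq_sum_range]
  fun_prop

theorem centredChar_eq_prod {n : ℕ} {s : Multiset ℝ}
    (h : genPoly n = (s.map fun q => Polynomial.C q * Polynomial.X + Polynomial.C (1 - q)).prod)
    (u : ℝ) : centredChar n u = (s.map fun q => bernChar q u).prod := by
  rw [centredChar, μ_eq_sum_of_genPoly_eq h, h]
  clear h
  induction s using Multiset.induction with
  | empty => simp
  | cons q s ih =>
    simp only [Multiset.map_cons, Multiset.prod_cons, Multiset.sum_cons, map_mul] at ih ⊢
    rw [← ih, bernChar_eq]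
    simp only [map_add, map_mul, Polynomial.aeval_C, Polynomial.aeval_X, Complex.coe_algebraMap]
    have : Complex.exp (-(u * ((q + s.sum : ℝ) : ℂ) * Complex.I)) =
        Complex.exp (-(u * q * Complex.I)) * Complex.exp (-(u * (s.sum : ℂ) * Complex.I)) := by
      rw [← Complex.exp_add]; push_cast; congr 1; ring
    rw [this]
    push_cast
    ring

theorem norm_centredChar_le {n : ℕ} (hn : 1 ≤ n) {u : ℝ} (hu : |u| ≤ Real.pi) :
    ‖centredChar n u‖ ≤ Real.exp (-(2 / Real.pi ^ 2) * (σsq n * u ^ 2)) := by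
  obtain ⟨s, hs, h⟩ := exists_genPoly_eq_prod n
  rw [centredChar_eq_prod h, σsq_eq_sum_of_genPoly_eq hn h]
  have hcos := Real.cos_le_one_sub_mul_cos_sq hu
  clear h
  induction s using Multiset.induction with
  | empty => simp
  | cons q s ih =>
    simp only [Multiset.mem_cons, forall_eq_or_imp] at hs
    simp only [Multiset.map_cons, Multiset.prod_cons, Multiset.sum_cons, norm_mul, add_mul, mul_add,
      Real.exp_add]
    refine mul_le_mul ((norm_bernChar_le q u).trans ?_) (ih hs.2) (norm_nonneg _)
      (Real.exp_pos _).le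
    rw [Real.exp_le_exp]
    have hv : 0 ≤ q * (1 - q) := mul_nonneg hs.1.1 (by linarith [hs.1.2])
    nlinarith

theorem norm_centredChar_sub_le {n : ℕ} (hn : 1 ≤ n) {u : ℝ} (hu : |u| ≤ 1) :
    ‖centredChar n u - Complex.exp ((-(σsq n * u ^ 2 / 2) : ℝ))‖ ≤ σsq n * (2 * |u| ^ 3) := by
  obtain ⟨s, hs, h⟩ := exists_genPoly_eq_prod n
  rw [centredChar_eq_prod h, σsq_eq_sum_of_genPoly_eq hn h]
  have hexp : Complex.exp ((-((s.map fun q => q * (1 - q)).sum * u ^ 2 / 2) : ℝ)) =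
      (s.map fun q => Complex.exp ((-(q * (1 - q) * u ^ 2 / 2) : ℝ))).prod := by
    clear hs h
    induction s using Multiset.induction with
    | empty => simp
    | cons q s ih =>
      simp only [Multiset.map_cons, Multiset.prod_cons, Multiset.sum_cons] at ih ⊢
      rw [← ih, ← Complex.exp_add]
      push_cast
      congr 1
      ring
  rw [hexp, ← Multiset.sum_map_mul_right]
  refine (norm_multiset_prod_sub_prod_le s _ _ _ ?_ ?_
    fun q hq => norm_bernChar_sub_le (hs q hq).1 (hs q hq).2 hu).1
  · intro q hq
    have hv : 0 ≤ q * (1 - q) := mul_nonneg (hs q hq).1 (by linarith [(hs q hq).2])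
    refine (norm_bernChar_le q u).trans ?_
    rw [Real.exp_le_one_iff]
    nlinarith [Real.cos_le_one u]
  · intro q hq
    have hv : 0 ≤ q * (1 - q) := mul_nonneg (hs q hq).1 (by linarith [(hs q hq).2])
    rw [← Complex.ofReal_exp, Complex.norm_real, Real.norm_of_nonneg (Real.exp_pos _).le,
      Real.exp_le_one_iff]
    have : 0 ≤ q * (1 - q) * u ^ 2 / 2 := by positivity
    linarith

section LocalLimit

open MeasureTheory Filter Topology

/-- The rescaled characteristic function, restricted to the range relevant for inversion. -/
noncomputable def truncChar (n : ℕ) (t : ℝ) : ℂ :=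
  (Set.Ioc (-Real.pi * √(σsq n)) (Real.pi * √(σsq n))).indicator
    (fun t => centredChar n (t / √(σsq n))) t

theorem measurable_truncChar (n : ℕ) : Measurable (truncChar n) :=
  ((continuous_centredChar n).comp (continuous_id.div_const _)).measurable.indicator
    measurableSet_Ioc

theorem norm_truncChar_le {n : ℕ} (hn : 1 ≤ n) (hσ : 0 < σsq n) (t : ℝ) :
    ‖truncChar n t‖ ≤ Real.exp (-(2 / Real.pi ^ 2) * t ^ 2) := by
  have hs : 0 < √(σsq n) := Real.sqrt_pos.2 hσ
  unfold truncChar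
  by_cases ht : t ∈ Set.Ioc (-Real.pi * √(σsq n)) (Real.pi * √(σsq n))
  · rw [Set.indicator_of_mem ht]
    have hu : |t / √(σsq n)| ≤ Real.pi := by
      rw [abs_le, le_div_iff₀ hs, div_le_iff₀ hs]
      exact ⟨ht.1.le, ht.2⟩
    refine (norm_centredChar_le hn hu).trans_eq ?_
    rw [div_pow, Real.sq_sqrt hσ.le, mul_div_cancel₀ _ hσ.ne']
  · rw [Set.indicator_of_notMem ht, norm_zero]
    positivity

theorem tendsto_sqrt_σsq : Tendsto (fun n => √(σsq n)) atTop atTop :=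
  Real.tendsto_sqrt_atTop.comp tendsto_σsq

theorem tendsto_truncChar (t : ℝ) :
    Tendsto (fun n => truncChar n t) atTop (𝓝 (Complex.exp ((-(t ^ 2 / 2) : ℝ)))) := by
  rw [tendsto_iff_norm_sub_tendsto_zero]
  have hlim : Tendsto (fun n => 2 * |t| ^ 3 / √(σsq n)) atTop (𝓝 0) :=
    tendsto_const_nhds.div_atTop tendsto_sqrt_σsq
  refine squeeze_zero' (Eventually.of_forall fun n => norm_nonneg _) ?_ hlim
  filter_upwards [eventually_ge_atTop 1, tendsto_σsq.eventually_gt_atTop 0,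
    tendsto_sqrt_σsq.eventually_gt_atTop |t|] with n hn hσ ht
  have hs : 0 < √(σsq n) := Real.sqrt_pos.2 hσ
  have hmem : t ∈ Set.Ioc (-Real.pi * √(σsq n)) (Real.pi * √(σsq n)) := by
    have h3 := Real.pi_gt_three
    have h4 := abs_lt.1 ht
    constructor <;> nlinarith
  have hu : |t / √(σsq n)| ≤ 1 := by
    rw [abs_div, abs_of_pos hs, div_le_one hs]
    exact ht.le
  have h := norm_centredChar_sub_le hn hu
  rw [truncChar, Set.indicator_of_mem hmem]
  rw [div_pow, Real.sq_sqrt hσ.le, mul_div_cancel₀ _ hσ.ne', abs_div, abs_of_pos hs] at h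
  refine h.trans_eq ?_
  nth_rewrite 1 [← Real.sq_sqrt hσ.le]
  field_simp

theorem integrable_exp_neg_sq_div_two :
    Integrable fun t : ℝ => Complex.exp ((-(t ^ 2 / 2) : ℝ)) := by
  have h := (integrable_exp_neg_mul_sq (b := 1 / 2) (by norm_num)).ofReal (𝕜 := ℂ)
  refine h.congr (Eventually.of_forall fun t => ?_)
  simp only [Complex.coe_algebraMap, ← Complex.ofReal_exp]
  norm_cast
  ring_nf

theorem integrable_truncChar {n : ℕ} (hn : 1 ≤ n) (hσ : 0 < σsq n) :
    Integrable (truncChar n) :=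
  (integrable_exp_neg_mul_sq (b := 2 / Real.pi ^ 2) (by positivity)).mono'
    (measurable_truncChar n).aestronglyMeasurable
    (Eventually.of_forall fun t => norm_truncChar_le hn hσ t)

theorem tendsto_integral_norm_truncChar_sub :
    Tendsto (fun n => ∫ t, ‖truncChar n t - Complex.exp ((-(t ^ 2 / 2) : ℝ))‖) atTop (𝓝 0) := by
  rw [show (0 : ℝ) = ∫ _ : ℝ, (0 : ℝ) by simp]
  refine tendsto_integral_filter_of_dominated_convergence
    (fun t => Real.exp (-(2 / Real.pi ^ 2) * t ^ 2) + ‖Complex.exp ((-(t ^ 2 / 2) : ℝ))‖) ?_ ?_ ?_ ?_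
  · exact Eventually.of_forall fun n => ((measurable_truncChar n).aestronglyMeasurable.sub
      integrable_exp_neg_sq_div_two.aestronglyMeasurable).norm
  · filter_upwards [eventually_ge_atTop 1, tendsto_σsq.eventually_gt_atTop 0] with n hn hσ
    refine Eventually.of_forall fun t => ?_
    rw [norm_norm]
    exact (norm_sub_le _ _).trans (add_le_add (norm_truncChar_le hn hσ t) le_rfl)
  · exact (integrable_exp_neg_mul_sq (b := 2 / Real.pi ^ 2) (by positivity)).add
      integrable_exp_neg_sq_div_two.norm
  · exact Eventually.of_forall fun t => tendsto_iff_norm_sub_tendsto_zero.1 (tendsto_truncChar t)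

/-- The mass which the law `p n ·` gives to the integer `m`. -/
noncomputable def pointMass (n : ℕ) (m : ℤ) : ℝ :=
  ∑ k ∈ Finset.range (n + 1), if (k : ℤ) = m then p n k else 0

theorem integral_exp_int_mul_I (j : ℤ) :
    ∫ u in (-Real.pi)..Real.pi, Complex.exp (j * Complex.I * u) =
      if j = 0 then 2 * (Real.pi : ℂ) else 0 := by
  split_ifs with hj
  · subst hj
    simp
    ring
  · have hc : (j : ℂ) * Complex.I ≠ 0 := mul_ne_zero (by exact_mod_cast hj) Complex.I_ne_zero
    rw [integral_exp_mul_complex hc, div_eq_zero_iff, sub_eq_zero]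
    left
    rw [Complex.exp_eq_exp_iff_exists_int]
    exact ⟨j, by push_cast; ring⟩

theorem integral_centredChar_mul_exp (n : ℕ) (m : ℤ) :
    ∫ u in (-Real.pi)..Real.pi, centredChar n u * Complex.exp (-(u * (m - μ n) * Complex.I)) =
      2 * Real.pi * pointMass n m := by
  have h : ∀ u : ℝ, centredChar n u * Complex.exp (-(u * (m - μ n) * Complex.I)) =
      ∑ k ∈ Finset.range (n + 1), (p n k : ℂ) *
        Complex.exp (((k - m : ℤ) : ℂ) * Complex.I * u) := by
    intro u
    simp only [centredChar, genPoly, map_sum, map_mul, map_pow, Polynomial.aeval_C,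
      Polynomial.aeval_X, Complex.coe_algebraMap, Finset.mul_sum, Finset.sum_mul]
    refine Finset.sum_congr rfl fun k _ => ?_
    rw [← Complex.exp_nat_mul, mul_left_comm, mul_assoc, ← Complex.exp_add, ← Complex.exp_add]
    push_cast
    congr 2
    ring
  simp only [h]
  rw [intervalIntegral.integral_finsetSum
    fun k _ => (Continuous.intervalIntegrable (by fun_prop) _ _)]
  simp only [intervalIntegral.integral_const_mul, integral_exp_int_mul_I, pointMass, sub_eq_zero]
  push_cast
  rw [Finset.mul_sum]
  refine Finset.sum_congr rfl fun k _ => ?_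
  split_ifs <;> simp [mul_comm]

theorem integral_truncChar_mul_exp {n : ℕ} (hσ : 0 < σsq n) (m : ℤ) :
    ∫ t, truncChar n t * Complex.exp (-(t * ((m - μ n) / √(σsq n) : ℝ) * Complex.I)) =
      √(σsq n) * (2 * Real.pi * pointMass n m) := by
  have hs : 0 < √(σsq n) := Real.sqrt_pos.2 hσ
  have h : ∀ t, truncChar n t * Complex.exp (-(t * ((m - μ n) / √(σsq n) : ℝ) * Complex.I)) =
      (Set.Ioc (-Real.pi * √(σsq n)) (Real.pi * √(σsq n))).indicator (fun t => centredChar n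
        (t / √(σsq n)) * Complex.exp (-((t / √(σsq n) : ℝ) * (m - μ n) * Complex.I))) t := by
    intro t
    rw [truncChar]
    by_cases ht : t ∈ Set.Ioc (-Real.pi * √(σsq n)) (Real.pi * √(σsq n))
    · rw [Set.indicator_of_mem ht, Set.indicator_of_mem ht]
      push_cast
      congr 3
      ring
    · rw [Set.indicator_of_notMem ht, Set.indicator_of_notMem ht, zero_mul]
  simp only [h]
  rw [integral_indicator measurableSet_Ioc, ← intervalIntegral.integral_of_le
      (by nlinarith [Real.pi_pos]),
    intervalIntegral.integral_comp_div (fun u : ℝ => centredChar n u *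
      Complex.exp (-(u * (m - μ n) * Complex.I))) hs.ne',
    mul_div_cancel_right₀ _ hs.ne', mul_div_cancel_right₀ _ hs.ne', integral_centredChar_mul_exp,
    Complex.real_smul]

theorem integral_exp_neg_sq_div_two_mul_exp (x : ℝ) :
    ∫ t : ℝ, Complex.exp ((-(t ^ 2 / 2) : ℝ)) * Complex.exp (-(t * x * Complex.I)) =
      √(2 * Real.pi) * Real.exp (-x ^ 2 / 2) := by
  have h := fourierIntegral_gaussian (b := 1 / 2) (by norm_num) (-x)
  have e : ∀ t : ℝ, Complex.exp ((-(t ^ 2 / 2) : ℝ)) * Complex.exp (-(t * x * Complex.I)) =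
      Complex.exp (Complex.I * -x * t) * Complex.exp (-(1 / 2) * t ^ 2) := by
    intro t
    rw [mul_comm]
    push_cast
    congr 2 <;> ring
  simp only [e]
  rw [h]
  congr 1
  · rw [Real.sqrt_eq_rpow, Complex.ofReal_cpow (by positivity)]
    push_cast
    congr 1
    ring
  · push_cast
    congr 1
    ring

theorem abs_sqrt_mul_pointMass_sub_le {n : ℕ} (hn : 1 ≤ n) (hσ : 0 < σsq n) (m : ℤ) :
    |√(σsq n) * pointMass n m
        - Real.exp (-((m - μ n) / √(σsq n)) ^ 2 / 2) / √(2 * Real.pi)| ≤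
      (∫ t, ‖truncChar n t - Complex.exp ((-(t ^ 2 / 2) : ℝ))‖) / (2 * Real.pi) := by
  set x := (m - μ n) / √(σsq n) with hx
  have h1 := integral_truncChar_mul_exp hσ m
  have h2 := integral_exp_neg_sq_div_two_mul_exp x
  rw [← hx] at h1
  have hcont : Continuous fun t : ℝ => Complex.exp (-(t * x * Complex.I)) := by fun_prop
  have hnorm : ∀ t : ℝ, ‖Complex.exp (-(t * x * Complex.I))‖ = 1 := fun t => by
    rw [Complex.norm_exp]; simp
  have hint : ∀ f : ℝ → ℂ, Integrable f →
      Integrable fun t => f t * Complex.exp (-(t * x * Complex.I)) := fun f hf =>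
    hf.mul_bdd (c := 1) hcont.aestronglyMeasurable (Eventually.of_forall fun t => (hnorm t).le)
  have h3 := integral_sub (hint _ (integrable_truncChar hn hσ))
    (hint _ integrable_exp_neg_sq_div_two)
  rw [h1, h2] at h3
  have h4 : ‖∫ t, (truncChar n t * Complex.exp (-(t * x * Complex.I))
      - Complex.exp ((-(t ^ 2 / 2) : ℝ)) * Complex.exp (-(t * x * Complex.I)))‖ ≤
      ∫ t, ‖truncChar n t - Complex.exp ((-(t ^ 2 / 2) : ℝ))‖ := by
    refine (norm_integral_le_integral_norm _).trans_eq ?_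
    congr 1
    ext t
    rw [← sub_mul, norm_mul, hnorm, mul_one]
  rw [h3] at h4
  have hp : 0 < 2 * Real.pi := by positivity
  rw [le_div_iff₀ hp]
  refine le_trans (le_of_eq ?_) h4
  have hsq : √(2 * Real.pi) * √(2 * Real.pi) = 2 * Real.pi := Real.mul_self_sqrt hp.le
  have hsp : √(2 * Real.pi) ≠ 0 := (Real.sqrt_pos.2 hp).ne'
  rw [← abs_of_pos hp, ← abs_mul, abs_of_pos hp, ← Real.norm_eq_abs, ← Complex.norm_real]
  congr 1
  norm_cast
  rw [sub_mul]
  congr 1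
  · ring
  · nth_rewrite 2 [← hsq]
    field_simp

theorem exists_local_limit_error : ∃ ε : ℕ → ℝ, Tendsto ε atTop (𝓝 0) ∧
    ∀ᶠ n in atTop, ∀ m : ℤ, |√(σsq n) * pointMass n m
        - Real.exp (-((m - μ n) / √(σsq n)) ^ 2 / 2) / √(2 * Real.pi)| ≤ ε n := by
  have h := tendsto_integral_norm_truncChar_sub.div_const (2 * Real.pi)
  rw [zero_div] at h
  refine ⟨_, h, ?_⟩
  filter_upwards [eventually_ge_atTop 1, tendsto_σsq.eventually_gt_atTop 0] with n hn hσ m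
  exact abs_sqrt_mul_pointMass_sub_le hn hσ m

/-- In the coordinates of `B`, the possible values of the chain form a lattice of mesh
`1 / scale δ n`. -/
noncomputable def scale (δ : ℝ) (n : ℕ) : ℝ := √(σsq n) * Real.log n ^ (-δ)

theorem tendsto_scale {δ : ℝ} (hδ : δ < 1 / 2) : Tendsto (scale δ) atTop atTop := by
  have hlim : Tendsto (fun n : ℕ => Real.log n ^ (1 / 2 - δ) * (1 / 3)) atTop atTop :=
    ((tendsto_rpow_atTop (by linarith)).comp tendsto_log_natCast).atTop_mul_const (by norm_num)
  refine tendsto_atTop_mono' _ ?_ hlim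
  filter_upwards [eventually_ge_atTop 1, tendsto_log_natCast.eventually_ge_atTop 2] with n hn hL
  have hL0 : 0 < Real.log n := by linarith
  have h := mul_log_sub_one_le_σsq hn
  have h2 : Real.log n ^ (1 / 2 : ℝ) * (1 / 3) ≤ √(σsq n) := by
    rw [← Real.sqrt_eq_rpow]
    refine Real.le_sqrt_of_sq_le ?_
    rw [mul_pow, Real.sq_sqrt hL0.le]
    linarith
  rw [scale, sub_eq_add_neg, Real.rpow_add hL0, mul_right_comm]
  exact mul_le_mul_of_nonneg_right h2 (Real.rpow_nonneg hL0.le _)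

theorem pointMass_eq_sum_Icc {n : ℕ} (hn : 1 ≤ n) (m : ℤ) :
    pointMass n m = ∑ k ∈ Finset.Icc 1 n, if (k : ℤ) = m then p n k else 0 := by
  obtain ⟨l, rfl⟩ := Nat.exists_eq_add_of_le' hn
  rw [pointMass, Finset.range_eq_Ico, Finset.sum_eq_sum_Ico_succ_bot (Nat.succ_pos _)]
  simp [p_succ_zero, Finset.Ico_add_one_right_eq_Icc]

open Classical in
/-- A step function on the lattice of mesh `1 / h` shifted by `y`. -/
noncomputable def stepFun (B : Set ℝ) (h y c : ℝ) (n : ℕ) (t : ℝ) : ℝ :=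
  ∑ k ∈ Finset.Icc 1 n, if ((k : ℝ) - y) / h ∈ B then
    (Set.Ico (((k : ℝ) - y) / h) (((k : ℝ) - y) / h + 1 / h)).indicator (fun _ => c * p n k) t
    else 0

open Classical in
theorem integral_stepFun (B : Set ℝ) {h : ℝ} (hh : 0 < h) (y c : ℝ) (n : ℕ) :
    ∫ t, stepFun B h y c n t =
      c / h * ∑ k ∈ (Finset.Icc 1 n).filter (fun k : ℕ => ((k : ℝ) - y) / h ∈ B), p n k := by
  have hint : ∀ k : ℕ, Integrable fun t => if ((k : ℝ) - y) / h ∈ B then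
      (Set.Ico (((k : ℝ) - y) / h) (((k : ℝ) - y) / h + 1 / h)).indicator (fun _ => c * p n k) t
      else 0 := by
    intro k
    split_ifs
    · exact (integrable_indicator_iff measurableSet_Ico).2
        (integrableOn_const measure_Ico_lt_top.ne)
    · exact integrable_zero _ _ _
  simp only [stepFun]
  rw [integral_finsetSum _ fun k _ => hint k, Finset.sum_filter, Finset.mul_sum]
  refine Finset.sum_congr rfl fun k _ => ?_
  split_ifs
  · rw [integral_indicator_const _ measurableSet_Ico]
    simp [hh.le]
    ring
  · simp

theorem measurable_stepFun (B : Set ℝ) (h y c : ℝ) (n : ℕ) : Measurable (stepFun B h y c n) := by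
  unfold stepFun
  refine Finset.measurable_sum _ fun k _ => ?_
  split_ifs
  · exact measurable_const.indicator measurableSet_Ico
  · exact measurable_const

open Classical in
theorem stepFun_eq (B : Set ℝ) {h : ℝ} (hh : 0 < h) (y c : ℝ) {n : ℕ} (hn : 1 ≤ n) (t : ℝ) :
    stepFun B h y c n t =
      if ((⌊h * t + y⌋ : ℝ) - y) / h ∈ B then c * pointMass n ⌊h * t + y⌋ else 0 := by
  have hmem : ∀ k : ℕ, t ∈ Set.Ico (((k : ℝ) - y) / h) (((k : ℝ) - y) / h + 1 / h) ↔
      (k : ℤ) = ⌊h * t + y⌋ := by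
    intro k
    rw [eq_comm, Int.floor_eq_iff, Set.mem_Ico, ← add_div, div_le_iff₀ hh, lt_div_iff₀ hh]
    push_cast
    constructor <;> rintro ⟨h1, h2⟩ <;> constructor <;> linarith
  rw [pointMass_eq_sum_Icc hn, Finset.mul_sum, stepFun]
  rw [← Finset.sum_const_zero (s := Finset.Icc 1 n), ← Finset.sum_ite_irrel]
  refine Finset.sum_congr rfl fun k _ => ?_
  simp only [Set.indicator_apply, hmem, mul_ite]
  by_cases hk : (k : ℤ) = ⌊h * t + y⌋
  · simp [← hk]
  · simp [hk]

theorem abs_floor_sub_div_sub_le {h : ℝ} (hh : 0 < h) (y t : ℝ) :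
    |((⌊h * t + y⌋ : ℝ) - y) / h - t| ≤ 1 / h := by
  have e : ((⌊h * t + y⌋ : ℝ) - y) / h - t = (⌊h * t + y⌋ - (h * t + y)) / h := by
    field_simp
    ring
  rw [e, abs_div, abs_of_pos hh]
  gcongr
  have h1 := Int.floor_le (h * t + y)
  have h2 := Int.lt_floor_add_one (h * t + y)
  rw [abs_le]
  constructor <;> linarith

theorem tendsto_stepFun {δ : ℝ} (hδ : δ ∈ Set.Ioo (0 : ℝ) (1 / 2)) (x : ℝ) (B : Set ℝ) {t : ℝ}
    (ht : t ∉ frontier B) :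
    Tendsto (fun n => stepFun B (scale δ n) (μ n + √(σsq n) * x) √(σsq n) n t) atTop
      (𝓝 ((interior B).indicator (fun _ => Real.exp (-x ^ 2 / 2) / √(2 * Real.pi)) t)) := by
  have hscale : Tendsto (scale δ) atTop atTop := tendsto_scale hδ.2
  set b : ℕ → ℝ := fun n =>
    ((⌊scale δ n * t + (μ n + √(σsq n) * x)⌋ : ℝ) - (μ n + √(σsq n) * x)) / scale δ n with hb
  have hbt : Tendsto b atTop (𝓝 t) := by
    rw [tendsto_iff_norm_sub_tendsto_zero]
    refine squeeze_zero' (Eventually.of_forall fun _ => norm_nonneg _) ?_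
      (tendsto_const_nhds.div_atTop hscale (a := (1 : ℝ)))
    filter_upwards [hscale.eventually_gt_atTop 0] with n hn
    exact abs_floor_sub_div_sub_le hn _ _
  by_cases hint : t ∈ interior B
  · rw [Set.indicator_of_mem hint]
    obtain ⟨ε, hε, hloc⟩ := exists_local_limit_error
    set m : ℕ → ℤ := fun n => ⌊scale δ n * t + (μ n + √(σsq n) * x)⌋ with hm
    have hx : Tendsto (fun n => (m n - μ n) / √(σsq n)) atTop (𝓝 x) := by
      have hpow : Tendsto (fun n : ℕ => Real.log n ^ (-δ)) atTop (𝓝 0) :=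
        (tendsto_rpow_neg_atTop hδ.1).comp tendsto_log_natCast
      have h := (hbt.mul hpow).const_add x
      rw [mul_zero, add_zero] at h
      refine h.congr' ?_
      filter_upwards [tendsto_sqrt_σsq.eventually_gt_atTop 0, hscale.eventually_gt_atTop 0]
        with n hs hn
      have hl : Real.log n ^ (-δ) = scale δ n / √(σsq n) := by
        rw [scale, mul_div_cancel_left₀ _ hs.ne']
      rw [hl]
      simp only [hb, hm]
      field_simp
      ring
    have hg : Continuous fun z : ℝ => Real.exp (-z ^ 2 / 2) / √(2 * Real.pi) := by fun_prop
    have h1 := (hg.tendsto x).comp hx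
    have h2 : Tendsto (fun n => √(σsq n) * pointMass n (m n)
        - Real.exp (-((m n - μ n) / √(σsq n)) ^ 2 / 2) / √(2 * Real.pi)) atTop (𝓝 0) := by
      refine squeeze_zero_norm' ?_ hε
      filter_upwards [hloc] with n hn
      exact hn (m n)
    have h3 := h2.add h1
    rw [zero_add] at h3
    refine h3.congr' ?_
    filter_upwards [hscale.eventually_gt_atTop 0, eventually_ge_atTop 1,
      hbt.eventually_mem (isOpen_interior.mem_nhds hint)] with n hn hn1 hbn
    rw [stepFun_eq B hn _ _ hn1, if_pos (interior_subset hbn)]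
    simp [hm]
  · rw [Set.indicator_of_notMem hint]
    have hcl : t ∈ (closure B)ᶜ := fun hc => ht ⟨hc, hint⟩
    refine tendsto_const_nhds.congr' ?_
    filter_upwards [hscale.eventually_gt_atTop 0, eventually_ge_atTop 1,
      hbt.eventually_mem (isClosed_closure.isOpen_compl.mem_nhds hcl)] with n hn hn1 hbn
    rw [stepFun_eq B hn _ _ hn1, if_neg fun hc => hbn (subset_closure hc)]

theorem tendsto_integral_stepFun {δ : ℝ} (hδ : δ ∈ Set.Ioo (0 : ℝ) (1 / 2)) (x : ℝ) {B : Set ℝ}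
    (hB_bdd : Bornology.IsBounded B) (hB_jordan : volume (frontier B) = 0) :
    Tendsto (fun n => ∫ t, stepFun B (scale δ n) (μ n + √(σsq n) * x) √(σsq n) n t) atTop
      (𝓝 (Real.exp (-x ^ 2 / 2) / √(2 * Real.pi) * (volume B).toReal)) := by
  have hscale : Tendsto (scale δ) atTop atTop := tendsto_scale hδ.2
  have hlim : Real.exp (-x ^ 2 / 2) / √(2 * Real.pi) * (volume B).toReal =
      ∫ t, (interior B).indicator (fun _ => Real.exp (-x ^ 2 / 2) / √(2 * Real.pi)) t := by
    rw [integral_indicator_const _ isOpen_interior.measurableSet, smul_eq_mul, mul_comm,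
      Measure.real, measure_interior_of_null_frontier hB_jordan]
  rw [hlim]
  obtain ⟨R, hR⟩ := hB_bdd.subset_closedBall 0
  obtain ⟨ε, hε, hloc⟩ := exists_local_limit_error
  refine tendsto_integral_filter_of_dominated_convergence
    ((Metric.closedBall (0 : ℝ) (R + 1)).indicator fun _ => (2 : ℝ)) ?_ ?_ ?_ ?_
  · exact Eventually.of_forall fun n => (measurable_stepFun _ _ _ _ _).aestronglyMeasurable
  · filter_upwards [hscale.eventually_ge_atTop 1, eventually_ge_atTop 1, hloc,
      hε.eventually_le_const zero_lt_one] with n hn hn1 hl he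
    refine Eventually.of_forall fun t => ?_
    rw [stepFun_eq B (by linarith) _ _ hn1]
    have hd := abs_floor_sub_div_sub_le (h := scale δ n) (by linarith) (μ n + √(σsq n) * x) t
    split_ifs with hmem
    · have h1 := mem_closedBall_zero_iff.1 (hR hmem)
      have h2 : 1 / scale δ n ≤ 1 := by rw [div_le_one (by linarith)]; exact hn
      have ht : t ∈ Metric.closedBall (0 : ℝ) (R + 1) := by
        rw [mem_closedBall_zero_iff]
        rw [Real.norm_eq_abs, abs_le] at h1 ⊢
        rw [abs_le] at hd
        constructor <;> linarith
      rw [Set.indicator_of_mem ht, Real.norm_eq_abs]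
      have h3 := hl ⌊scale δ n * t + (μ n + √(σsq n) * x)⌋
      set z := ((⌊scale δ n * t + (μ n + √(σsq n) * x)⌋ : ℝ) - μ n) / √(σsq n)
      have h4 : Real.exp (-z ^ 2 / 2) / √(2 * Real.pi) ≤ 1 := by
        have h5 : Real.exp (-z ^ 2 / 2) ≤ 1 := Real.exp_le_one_iff.2 (by nlinarith [sq_nonneg z])
        refine div_le_one_of_le₀ (h5.trans ?_) (Real.sqrt_nonneg _)
        rw [Real.one_le_sqrt]
        linarith [Real.pi_gt_three]
      have h6 : 0 ≤ Real.exp (-z ^ 2 / 2) / √(2 * Real.pi) := by positivity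
      rw [abs_le] at h3 ⊢
      constructor <;> linarith
    · rw [norm_zero]
      exact Set.indicator_nonneg (fun _ _ => zero_le_two) t
  · exact (integrable_indicator_iff measurableSet_closedBall).2
      (integrableOn_const measure_closedBall_lt_top.ne)
  · have : ∀ᵐ t : ℝ, t ∉ frontier B := measure_eq_zero_iff_ae_notMem.1 hB_jordan
    filter_upwards [this] with t ht
    exact tendsto_stepFun hδ x B ht

end LocalLimit

open scoped Classical Pointwise

open MeasureTheory in
/-- Local limit theorem: for `δ ∈ (0, 1/2)`, `x ∈ ℝ` and a bounded Jordan measurable set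
`B ⊆ ℝ` (its boundary has Lebesgue measure zero) of positive Lebesgue (= Jordan)
measure `J(B)`,
`lim_{n→∞} (log n)^δ P((f_0(T_n) − μ_n)/σ_n − x ∈ (log n)^{−δ} B)
  = (e^{−x²/2}/√(2π)) J(B)`,
where the probability is `Σ_{k : (k − μ_n)/σ_n − x ∈ (log n)^{−δ}·B} p_k^{(n)}` and
`(log n)^{−δ}·B` is the dilation `{(log n)^{−δ} b : b ∈ B}`. -/
theorem local_limit_theorem (δ : ℝ) (hδ : δ ∈ Set.Ioo (0 : ℝ) (1 / 2)) (x : ℝ)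
    (B : Set ℝ) (hB_bdd : Bornology.IsBounded B) (hB_jordan : volume (frontier B) = 0)
    (hB_pos : 0 < (volume B).toReal) :
    Filter.Tendsto
      (fun n : ℕ =>
        Real.log n ^ δ *
          ∑ k ∈ (Finset.Icc 1 n).filter
              (fun k : ℕ =>
                ((k : ℝ) - μ n) / Real.sqrt (σsq n) - x ∈ (Real.log n ^ (-δ)) • B),
            p n k)
      Filter.atTop
      (nhds (Real.exp (-x ^ 2 / 2) / Real.sqrt (2 * Real.pi) * (volume B).toReal)) := by
  refine (tendsto_integral_stepFun hδ x hB_bdd hB_jordan).congr' ?_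
  have hscale : Filter.Tendsto (scale δ) Filter.atTop Filter.atTop :=
    tendsto_scale hδ.2
  filter_upwards [hscale.eventually_gt_atTop 0, tendsto_sqrt_σsq.eventually_gt_atTop 0,
    tendsto_log_natCast.eventually_gt_atTop 0] with n hn hs hL
  have hpow : 0 < Real.log n ^ (-δ) := Real.rpow_pos_of_pos hL _
  have hcoef : √(σsq n) / scale δ n = Real.log n ^ δ := by
    rw [scale, div_mul_eq_div_div, div_self hs.ne', Real.rpow_neg hL.le, one_div, inv_inv]
  rw [integral_stepFun B hn, hcoef]
  congr 1
  refine Finset.sum_congr (Finset.filter_congr fun k _ => ?_) fun _ _ => rfl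
  rw [Set.mem_smul_set_iff_inv_smul_mem₀ hpow.ne', smul_eq_mul]
  have e : ((k : ℝ) - (μ n + √(σsq n) * x)) / scale δ n =
      (Real.log n ^ (-δ))⁻¹ * (((k : ℝ) - μ n) / √(σsq n) - x) := by
    rw [scale]
    field_simp
    ring
  rw [e]
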